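/- Let J₁(x) = (1/π)∫₀^π cos(θ − x sin θ) dθ. Let f : (0, ∞) → ℝ be continuous, of bounded variation on every compact subinterval of (0, ∞), and satisfy ∫₀^∞ |f(r)|·√r dr < ∞. Define F₁(p) = ∫₀^∞ f(s)·J₁(p s)·s ds for p > 0. Then for every r > 0, the Hankel inversion formula holds: f(r) = lim_{R → ∞} ∫₀^R F₁(p)·J₁(p r)·p dp. -/

import Mathlib

open Real MeasureTheory Filter Topology

noncomputable def J1 (x : ℝ) : ℝ := (1 / π) * ∫ θ in (0:ℝ)..π, Real.cos (θ - x * Real.sin θ)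

lemma exists_Ioc_ae_eq_of_monotone {φ : ℝ → ℝ} (hφ : Monotone φ) {a b : ℝ} (hab : a ≤ b) (t : ℝ) :
    ∃ c ∈ Set.Icc a b, (Set.Ioc a b ∩ {x | t < φ x} : Set ℝ) =ᵐ[volume] Set.Ioc c b := by
  obtain ⟨c, hc, h1, h2⟩ : ∃ c ∈ Set.Icc a b, (∀ x ∈ Set.Ioc c b, t < φ x) ∧
      ∀ x ∈ Set.Ioo a c, φ x ≤ t := by
    rcases Set.eq_empty_or_nonempty {x ∈ Set.Icc a b | φ x ≤ t} with h | h
    · refine ⟨a, ⟨le_rfl, hab⟩, fun x hx => ?_, fun x hx => absurd (hx.1.trans hx.2) (lt_irrefl _)⟩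
      by_contra! hlt
      exact (h.subset ⟨⟨hx.1.le, hx.2⟩, hlt⟩ : x ∈ (∅ : Set ℝ))
    · have hbdd : BddAbove {x ∈ Set.Icc a b | φ x ≤ t} := ⟨b, fun x hx => hx.1.2⟩
      obtain ⟨y, hy⟩ := h
      refine ⟨sSup {x ∈ Set.Icc a b | φ x ≤ t}, ⟨hy.1.1.trans (le_csSup hbdd hy),
        csSup_le ⟨y, hy⟩ fun x hx => hx.1.2⟩, fun x hx => ?_, fun x hx => ?_⟩
      · by_contra! hlt
        exact absurd (le_csSup hbdd
          ⟨⟨(hy.1.1.trans (le_csSup hbdd hy)).trans hx.1.le, hx.2⟩, hlt⟩) (not_le.2 hx.1)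
      · obtain ⟨z, hz, hxz⟩ := exists_lt_of_lt_csSup ⟨y, hy⟩ hx.2
        exact (hφ hxz.le).trans hz.2
  refine ⟨c, hc, ?_⟩
  filter_upwards [compl_mem_ae_iff.2 (measure_singleton (μ := volume) c)] with x hx
  refine propext ⟨fun h => ⟨?_, h.1.2⟩, fun h => ⟨⟨hc.1.trans_lt h.1, h.2⟩, h1 x h⟩⟩
  by_contra! hle
  exact absurd (h2 x ⟨h.1.1, lt_of_le_of_ne hle hx⟩) (not_le.2 h.2)

lemma abs_integral_mul_le_of_monotone {φ k : ℝ → ℝ} (hφ : Monotone φ) {a b m M : ℝ} (hab : a ≤ b)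
    (hφ0 : ∀ x, 0 ≤ φ x) (hφm : ∀ x, φ x ≤ m) (hk : IntegrableOn k (Set.Ioc a b))
    (hM : ∀ c ∈ Set.Icc a b, |∫ x in Set.Ioc c b, k x| ≤ M) :
    |∫ x in Set.Ioc a b, φ x * k x| ≤ m * M := by
  have hm : 0 ≤ m := (hφ0 0).trans (hφm 0)
  have hint : Integrable (Function.uncurry fun t x => Set.indicator {x | t < φ x} k x)
      ((volume.restrict (Set.Ioc 0 m)).prod (volume.restrict (Set.Ioc a b))) :=
    (hk.comp_snd (volume.restrict (Set.Ioc 0 m))).indicator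
      (measurableSet_lt measurable_fst (hφ.measurable.comp measurable_snd))
  have hcake : ∀ x, ∫ t in Set.Ioc 0 m, Set.indicator {x | t < φ x} k x = φ x * k x := by
    intro x
    have : (fun t => Set.indicator {x | t < φ x} k x) =
        Set.indicator (Set.Iio (φ x)) (fun _ => k x) := by
      ext t; simp [Set.indicator_apply]
    rw [this, setIntegral_indicator measurableSet_Iio]
    have hset : Set.Ioc 0 m ∩ Set.Iio (φ x) = Set.Ioo 0 (φ x) := by
      ext t
      simp only [Set.mem_inter_iff, Set.mem_Ioc, Set.mem_Iio, Set.mem_Ioo]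
      exact ⟨fun h => ⟨h.1.1, h.2⟩, fun h => ⟨⟨h.1, h.2.le.trans (hφm x)⟩, h.2⟩⟩
    simp [hset, hφ0 x]
  simp_rw [← hcake]
  rw [← integral_integral_swap hint]
  have hin : ∀ t, |∫ x in Set.Ioc a b, Set.indicator {x | t < φ x} k x| ≤ M := by
    intro t
    obtain ⟨c, hc, hset⟩ := exists_Ioc_ae_eq_of_monotone hφ hab t
    rw [setIntegral_indicator (measurableSet_lt measurable_const hφ.measurable),
      setIntegral_congr_set hset]
    exact hM c hc
  have := norm_setIntegral_le_of_norm_le_const (μ := volume) (s := Set.Ioc 0 m) (C := M)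
    (f := fun t => ∫ x in Set.Ioc a b, Set.indicator {x | t < φ x} k x) (by simp)
    (fun t _ => hin t)
  simpa [hm, mul_comm] using this

/-- A form of the second mean value theorem for integrals. -/
lemma abs_integral_mul_le_of_monotoneOn {φ k : ℝ → ℝ} {a b m M : ℝ} (hab : a ≤ b)
    (hφ : MonotoneOn φ (Set.Icc a b)) (hm : ∀ x ∈ Set.Icc a b, |φ x| ≤ m)
    (hk : IntervalIntegrable k volume a b)
    (hM : ∀ c ∈ Set.Icc a b, |∫ x in c..b, k x| ≤ M) :
    |∫ x in a..b, φ x * k x| ≤ 3 * m * M := by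
  have hk' : IntegrableOn k (Set.Ioc a b) := (intervalIntegrable_iff_integrableOn_Ioc_of_le hab).1 hk
  have hM' : ∀ c ∈ Set.Icc a b, |∫ x in Set.Ioc c b, k x| ≤ M := fun c hc => by
    rw [← intervalIntegral.integral_of_le hc.2]; exact hM c hc
  have hm0 : 0 ≤ m := (abs_nonneg _).trans (hm a ⟨le_rfl, hab⟩)
  set ψ : ℝ → ℝ := fun x => φ (Set.projIcc a b hab x) + m with hψ
  have hψm : Monotone ψ := fun x y hxy =>
    add_le_add_left (hφ (Set.projIcc a b hab x).2 (Set.projIcc a b hab y).2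
      (Set.monotone_projIcc hab hxy)) _
  have hb : ∀ x, -m ≤ φ (Set.projIcc a b hab x) ∧ φ (Set.projIcc a b hab x) ≤ m :=
    fun x => abs_le.1 (hm _ (Set.projIcc a b hab x).2)
  have h1 := abs_integral_mul_le_of_monotone hψm (m := 2 * m) hab
    (fun x => by simp only [hψ]; linarith [(hb x).1])
    (fun x => by simp only [hψ]; linarith [(hb x).2]) hk' hM'
  have h2 := hM' a ⟨le_rfl, hab⟩
  have hψk : IntegrableOn (fun x => ψ x * k x) (Set.Ioc a b) := by
    refine hk'.bdd_mul (c := 2 * m) hψm.measurable.aestronglyMeasurable (ae_of_all _ fun x => ?_)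
    rw [Real.norm_eq_abs, abs_le]
    constructor <;> simp only [hψ] <;> linarith [(hb x).1, (hb x).2]
  have h3 : ∫ x in a..b, φ x * k x =
      (∫ x in Set.Ioc a b, ψ x * k x) - m * ∫ x in Set.Ioc a b, k x := by
    rw [intervalIntegral.integral_of_le hab, ← integral_const_mul,
      ← integral_sub hψk (hk'.const_mul m)]
    refine setIntegral_congr_fun measurableSet_Ioc fun x hx => ?_
    simp only [hψ, Set.projIcc_of_mem hab (Set.Ioc_subset_Icc_self hx)]
    ring
  rw [h3]
  calc _ ≤ |∫ x in Set.Ioc a b, ψ x * k x| + |m * ∫ x in Set.Ioc a b, k x| := abs_sub _ _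
    _ ≤ 2 * m * M + m * M := by
      rw [abs_mul, abs_of_nonneg hm0]
      gcongr
    _ = 3 * m * M := by ring

lemma abs_integral_sin_le (a b : ℝ) : |∫ x in a..b, sin x| ≤ 2 := by
  rw [integral_sin, abs_le]
  constructor <;> linarith [neg_one_le_cos a, cos_le_one a, neg_one_le_cos b, cos_le_one b]

lemma abs_integral_sinc_zero_le_of_nonneg {x : ℝ} (hx : 0 ≤ x) : |∫ y in (0:ℝ)..x, sinc y| ≤ 7 := by
  have hsmall : ∀ z, 0 ≤ z → z ≤ 1 → |∫ y in (0:ℝ)..z, sinc y| ≤ 1 := fun z h0 h1 => by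
    have := intervalIntegral.norm_integral_le_of_norm_le_const (a := 0) (b := z) (f := sinc)
      (C := 1) (fun y _ => abs_sinc_le_one y)
    rw [Real.norm_eq_abs, sub_zero, abs_of_nonneg h0, one_mul] at this
    exact this.trans h1
  rcases le_total x 1 with h | h
  · linarith [hsmall x hx h]
  · have hi : ∀ a b, IntervalIntegrable sinc volume a b :=
      fun a b => continuous_sinc.intervalIntegrable a b
    rw [← intervalIntegral.integral_add_adjacent_intervals (hi 0 1) (hi 1 x)]
    have h2 : |∫ y in (1:ℝ)..x, (-y⁻¹) * sin y| ≤ 3 * 1 * 2 := by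
      refine abs_integral_mul_le_of_monotoneOn h (fun y hy z hz hyz => ?_) (fun y hy => ?_)
        (continuous_sin.intervalIntegrable _ _) (fun c _ => abs_integral_sin_le c x)
      · have : 0 < y := by linarith [hy.1]
        simpa using inv_anti₀ this hyz
      · have : 0 < y := by linarith [hy.1]
        rw [abs_neg, abs_of_pos (inv_pos.2 this)]
        exact inv_le_one_of_one_le₀ hy.1
    have h3 : ∫ y in (1:ℝ)..x, sinc y = - ∫ y in (1:ℝ)..x, (-y⁻¹) * sin y := by
      rw [← intervalIntegral.integral_neg]
      refine intervalIntegral.integral_congr fun y hy => ?_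
      rw [Set.uIcc_of_le h] at hy
      rw [sinc_of_ne_zero (by linarith [hy.1])]
      ring
    have h4 := hsmall 1 zero_le_one le_rfl
    rw [h3]
    refine (abs_add_le _ _).trans ?_
    rw [abs_neg]
    linarith

lemma abs_integral_sinc_le (a b : ℝ) : |∫ y in a..b, sinc y| ≤ 14 := by
  have hi : ∀ a b, IntervalIntegrable sinc volume a b :=
    fun a b => continuous_sinc.intervalIntegrable a b
  have h0 : ∀ x, |∫ y in (0:ℝ)..x, sinc y| ≤ 7 := fun x => by
    rcases le_total 0 x with h | h
    · exact abs_integral_sinc_zero_le_of_nonneg h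
    · have h1 := abs_integral_sinc_zero_le_of_nonneg (neg_nonneg.2 h)
      have h2 := intervalIntegral.integral_comp_neg (a := 0) (b := x) sinc
      simp only [sinc_neg, neg_zero] at h2
      rwa [h2, intervalIntegral.integral_symm, abs_neg]
  rw [← intervalIntegral.integral_interval_sub_left (hi 0 b) (hi 0 a)]
  exact (abs_sub _ _).trans (by linarith [h0 a, h0 b])

/-- A continuous function of bounded variation that vanishes at `r` has small integrals near `r`
against kernels whose integrals are uniformly bounded. -/
lemma exists_abs_integral_mul_le_of_boundedVariationOn {f : ℝ → ℝ} {a b r : ℝ}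
    (har : a < r) (hrb : r < b) (hf : BoundedVariationOn f (Set.Icc a b)) (hfc : ContinuousAt f r)
    (hfr : f r = 0)
    {ε M : ℝ} (hε : 0 < ε) (hM0 : 0 ≤ M) :
    ∃ δ > 0, a ≤ r - δ ∧ r + δ ≤ b ∧ ∀ k : ℝ → ℝ, Continuous k →
      (∀ c d, a ≤ c → c ≤ d → d ≤ b → |∫ x in c..d, k x| ≤ M) →
      |∫ x in (r - δ)..(r + δ), f x * k x| ≤ ε := by
  have hr : r ∈ Set.Icc a b := ⟨har.le, hrb.le⟩
  have hlf : LocallyBoundedVariationOn f (Set.Icc a b) := hf.locallyBoundedVariationOn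
  set V := variationOnFromTo f (Set.Icc a b) r with hV
  have hVr : V r = 0 := variationOnFromTo.self f _ r
  have hVmono : MonotoneOn V (Set.Icc a b) := variationOnFromTo.monotoneOn hlf hr
  have hVfmono : MonotoneOn (V - f) (Set.Icc a b) := variationOnFromTo.sub_self_monotoneOn hlf hr
  have hleft : Tendsto V (𝓝[Set.Icc a b ∩ Set.Iio r] r) (𝓝 0) := by
    simpa [variationOnFromTo.self] using variationOnFromTo.tendsto_left hr hr hlf
      (hfc.continuousWithinAt (s := Set.Icc a b ∩ Set.Iio r))
  have hright : Tendsto V (𝓝[Set.Icc a b ∩ Set.Ioi r] r) (𝓝 0) := by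
    simpa [variationOnFromTo.self] using variationOnFromTo.tendsto_right hr hr hlf
      (hfc.continuousWithinAt (s := Set.Icc a b ∩ Set.Ioi r))
  have hab : Set.Icc a b ∈ 𝓝 r := Icc_mem_nhds har hrb
  rw [nhdsWithin_inter_of_mem (mem_nhdsWithin_of_mem_nhds hab)] at hleft hright
  have hVc : Tendsto V (𝓝 r) (𝓝 0) := by
    rw [← nhdsNE_sup_pure, ← nhdsLT_sup_nhdsGT]
    exact (hleft.sup hright).sup (by simpa [hVr] using tendsto_pure_nhds V r)
  have hVfc : Tendsto (V - f) (𝓝 r) (𝓝 0) := by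
    simpa [hfr] using! hVc.sub hfc.tendsto
  set η := ε / (6 * (M + 1)) with hη
  have hη0 : 0 < η := by positivity
  obtain ⟨δ₁, hδ₁, h1⟩ := Metric.eventually_nhds_iff.1
    ((Metric.tendsto_nhds.1 hVc η hη0).and
      ((Metric.tendsto_nhds.1 hVfc η hη0).and hab))
  refine ⟨δ₁ / 2, by positivity, ?_⟩
  have hmem : ∀ x ∈ Set.Icc (r - δ₁ / 2) (r + δ₁ / 2), |V x| ≤ η ∧ |(V - f) x| ≤ η ∧
      x ∈ Set.Icc a b := fun x hx => by
    have := h1 (y := x) (by rw [Real.dist_eq, abs_lt]; constructor <;> linarith [hx.1, hx.2])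
    simp only [Real.dist_eq, sub_zero] at this
    exact ⟨this.1.le, this.2.1.le, this.2.2⟩
  have hle : r - δ₁ / 2 ≤ r + δ₁ / 2 := by linarith
  have hl := (hmem _ ⟨le_rfl, hle⟩).2.2.1
  have hu := (hmem _ ⟨hle, le_rfl⟩).2.2.2
  refine ⟨hl, hu, fun k hk hkM => ?_⟩
  have hsub : Set.Icc (r - δ₁ / 2) (r + δ₁ / 2) ⊆ Set.Icc a b := fun x hx => (hmem x hx).2.2
  have hi : ∀ φ : ℝ → ℝ, MonotoneOn φ (Set.Icc a b) →
      IntervalIntegrable (fun x => φ x * k x) volume (r - δ₁ / 2) (r + δ₁ / 2) := fun φ hφ =>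
    (MonotoneOn.intervalIntegrable (by rw [Set.uIcc_of_le hle]; exact hφ.mono hsub)).mul_continuousOn
      hk.continuousOn
  have hb : ∀ φ : ℝ → ℝ, MonotoneOn φ (Set.Icc a b) →
      (∀ x ∈ Set.Icc (r - δ₁ / 2) (r + δ₁ / 2), |φ x| ≤ η) →
      |∫ x in (r - δ₁ / 2)..(r + δ₁ / 2), φ x * k x| ≤ 3 * η * M := fun φ hφ hm =>
    abs_integral_mul_le_of_monotoneOn hle (hφ.mono hsub) hm (hk.intervalIntegrable _ _)
      fun c hc => hkM c _ (hl.trans hc.1) hc.2 hu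
  have hsplit : ∫ x in (r - δ₁ / 2)..(r + δ₁ / 2), f x * k x =
      (∫ x in (r - δ₁ / 2)..(r + δ₁ / 2), V x * k x) -
        ∫ x in (r - δ₁ / 2)..(r + δ₁ / 2), (V - f) x * k x := by
    rw [← intervalIntegral.integral_sub (hi _ hVmono) (hi _ hVfmono)]
    congr 1
    ext x
    simp only [Pi.sub_apply]
    ring
  rw [hsplit]
  refine (abs_sub _ _).trans ?_
  have h2 := hb V hVmono fun x hx => (hmem x hx).1
  have h3 := hb (V - f) hVfmono fun x hx => (hmem x hx).2.1
  have h4 : 6 * η * (M + 1) = ε := by rw [hη]; field_simp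
  nlinarith

/-- The Bessel function of the first kind of order `0`. -/
noncomputable def besselJ0 (x : ℝ) : ℝ := (1 / π) * ∫ θ in (0:ℝ)..π, cos (x * sin θ)

lemma J1_eq_integral_sin_mul_sin (x : ℝ) :
    J1 x = (1 / π) * ∫ θ in (0:ℝ)..π, sin θ * sin (x * sin θ) := by
  have h0 : ∫ θ in (0:ℝ)..π, cos θ * cos (x * sin θ) = 0 := by
    have h := intervalIntegral.integral_comp_sub_left (a := 0) (b := π)
      (fun θ => cos θ * cos (x * sin θ)) π
    simp only [cos_pi_sub, sin_pi_sub, sub_self, sub_zero, neg_mul,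
      intervalIntegral.integral_neg] at h
    linarith
  rw [J1]
  congr 1
  simp_rw [cos_sub]
  rw [intervalIntegral.integral_add (Continuous.intervalIntegrable (by fun_prop) _ _)
    (Continuous.intervalIntegrable (by fun_prop) _ _), h0, zero_add]

lemma continuous_besselJ0 : Continuous besselJ0 := by
  unfold besselJ0
  exact continuous_const.mul
    (intervalIntegral.continuous_parametric_intervalIntegral_of_continuous' (by fun_prop) _ _)

lemma continuous_J1 : Continuous J1 := by
  unfold J1
  exact continuous_const.mul
    (intervalIntegral.continuous_parametric_intervalIntegral_of_continuous' (by fun_prop) _ _)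

lemma besselJ0_zero : besselJ0 0 = 1 := by simp [besselJ0, pi_ne_zero]

lemma J1_zero : J1 0 = 0 := by simp [J1_eq_integral_sin_mul_sin]

lemma abs_mean_le {g : ℝ → ℝ} {c : ℝ} (hg : ∀ θ, |g θ| ≤ c) :
    |(1 / π) * ∫ θ in (0:ℝ)..π, g θ| ≤ c := by
  have h := intervalIntegral.norm_integral_le_of_norm_le_const (a := 0) (b := π) (f := g)
      (C := c) (fun y _ => hg y)
  rw [Real.norm_eq_abs, sub_zero, abs_of_pos pi_pos] at h
  rw [abs_mul, abs_of_pos (by positivity : 0 < 1 / π), one_div, inv_mul_le_iff₀ pi_pos]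
  linarith

lemma abs_besselJ0_le_one (x : ℝ) : |besselJ0 x| ≤ 1 := abs_mean_le fun _ => abs_cos_le_one _

lemma abs_J1_le_one (x : ℝ) : |J1 x| ≤ 1 := abs_mean_le fun _ => abs_cos_le_one _

lemma abs_J1_le_abs (x : ℝ) : |J1 x| ≤ |x| := by
  rw [J1_eq_integral_sin_mul_sin]
  refine abs_mean_le fun θ => ?_
  calc |sin θ * sin (x * sin θ)| ≤ 1 * (|x| * 1) := by
        rw [abs_mul]
        have h1 := abs_sin_le_one θ
        have h2 : |sin (x * sin θ)| ≤ |x| * |sin θ| := abs_mul x _ ▸ abs_sin_le_abs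
        gcongr
        exact h2.trans (by gcongr)
    _ = |x| := by ring

lemma hasDerivAt_integral_mul_cos {a : ℝ → ℝ} (ha : Continuous a) (x : ℝ) :
    HasDerivAt (fun x => ∫ θ in (0:ℝ)..π, a θ * cos (x * sin θ))
      (∫ θ in (0:ℝ)..π, a θ * (-sin (x * sin θ) * sin θ)) x := by
  refine (intervalIntegral.hasDerivAt_integral_of_dominated_loc_of_deriv_le
    (F' := fun x θ => a θ * (-sin (x * sin θ) * sin θ))
    (bound := fun θ => |a θ|) univ_mem (Eventually.of_forall fun y => ?_) ?_ ?_ ?_ ?_ ?_).2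
  · exact (by fun_prop : Continuous fun θ => a θ * cos (y * sin θ)).aestronglyMeasurable
  · exact Continuous.intervalIntegrable (by fun_prop) _ _
  · exact (by fun_prop : Continuous
      fun θ => a θ * (-sin (x * sin θ) * sin θ)).aestronglyMeasurable
  · refine ae_of_all _ fun θ _ y _ => ?_
    rw [Real.norm_eq_abs, abs_mul, abs_mul, abs_neg]
    refine mul_le_of_le_one_right (abs_nonneg _) ?_
    exact mul_le_one₀ (abs_sin_le_one _) (abs_nonneg _) (abs_sin_le_one _)
  · exact ha.abs.intervalIntegrable _ _
  · refine ae_of_all _ fun θ _ y _ => ?_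
    have h : HasDerivAt (fun y => y * sin θ) (sin θ) y := by
      simpa using (hasDerivAt_id y).mul_const (sin θ)
    exact h.cos.const_mul (a θ)

lemma hasDerivAt_integral_mul_sin {a : ℝ → ℝ} (ha : Continuous a) (x : ℝ) :
    HasDerivAt (fun x => ∫ θ in (0:ℝ)..π, a θ * sin (x * sin θ))
      (∫ θ in (0:ℝ)..π, a θ * (cos (x * sin θ) * sin θ)) x := by
  refine (intervalIntegral.hasDerivAt_integral_of_dominated_loc_of_deriv_le
    (F' := fun x θ => a θ * (cos (x * sin θ) * sin θ))
    (bound := fun θ => |a θ|) univ_mem (Eventually.of_forall fun y => ?_) ?_ ?_ ?_ ?_ ?_).2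
  · exact (by fun_prop : Continuous fun θ => a θ * sin (y * sin θ)).aestronglyMeasurable
  · exact Continuous.intervalIntegrable (by fun_prop) _ _
  · exact (by fun_prop : Continuous
      fun θ => a θ * (cos (x * sin θ) * sin θ)).aestronglyMeasurable
  · refine ae_of_all _ fun θ _ y _ => ?_
    rw [Real.norm_eq_abs, abs_mul, abs_mul]
    refine mul_le_of_le_one_right (abs_nonneg _) ?_
    exact mul_le_one₀ (abs_cos_le_one _) (abs_nonneg _) (abs_sin_le_one _)
  · exact ha.abs.intervalIntegrable _ _
  · refine ae_of_all _ fun θ _ y _ => ?_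
    have h : HasDerivAt (fun y => y * sin θ) (sin θ) y := by
      simpa using (hasDerivAt_id y).mul_const (sin θ)
    exact h.sin.const_mul (a θ)

lemma hasDerivAt_besselJ0 (x : ℝ) : HasDerivAt besselJ0 (-J1 x) x := by
  have h := (hasDerivAt_integral_mul_cos (a := fun _ => 1) continuous_const x).const_mul (1 / π)
  simp only [one_mul] at h
  refine HasDerivAt.congr_deriv (f := besselJ0) h ?_
  rw [J1_eq_integral_sin_mul_sin, ← mul_neg, ← intervalIntegral.integral_neg]
  congr 2
  ext θ
  ring

lemma mul_integral_cos_sq_mul_cos (x : ℝ) :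
    x * ∫ θ in (0:ℝ)..π, cos θ ^ 2 * cos (x * sin θ) =
      ∫ θ in (0:ℝ)..π, sin θ * sin (x * sin θ) := by
  have h : ∀ θ ∈ Set.uIcc 0 π, HasDerivAt (fun θ => cos θ * sin (x * sin θ))
      (-sin θ * sin (x * sin θ) + cos θ * (cos (x * sin θ) * (x * cos θ))) θ := fun θ _ =>
    (hasDerivAt_cos θ).mul ((hasDerivAt_sin θ).const_mul x).sin
  have h1 := intervalIntegral.integral_eq_sub_of_hasDerivAt h
    (Continuous.intervalIntegrable (by fun_prop) _ _)
  rw [intervalIntegral.integral_add (Continuous.intervalIntegrable (by fun_prop) _ _)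
    (Continuous.intervalIntegrable (by fun_prop) _ _)] at h1
  simp only [neg_mul, intervalIntegral.integral_neg, sin_pi, sin_zero, mul_zero, sub_self] at h1
  rw [← intervalIntegral.integral_const_mul]
  have h2 : ∀ θ, x * (cos θ ^ 2 * cos (x * sin θ)) =
    cos θ * (cos (x * sin θ) * (x * cos θ)) := fun θ => by ring
  simp_rw [h2]
  linarith

lemma hasDerivAt_J1 {x : ℝ} (hx : x ≠ 0) : HasDerivAt J1 (besselJ0 x - J1 x / x) x := by
  have h := (hasDerivAt_integral_mul_sin continuous_sin x).const_mul (1 / π)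
  rw [show J1 = fun x => (1 / π) * ∫ θ in (0:ℝ)..π, sin θ * sin (x * sin θ) from
    funext J1_eq_integral_sin_mul_sin]
  refine HasDerivAt.congr_deriv h ?_
  have h1 : ∀ θ, sin θ * (cos (x * sin θ) * sin θ) =
      cos (x * sin θ) - cos θ ^ 2 * cos (x * sin θ) := fun θ => by
    linear_combination cos (x * sin θ) * sin_sq_add_cos_sq θ
  simp_rw [h1]
  rw [intervalIntegral.integral_sub (Continuous.intervalIntegrable (by fun_prop) _ _)
    (Continuous.intervalIntegrable (by fun_prop) _ _), ← mul_integral_cos_sq_mul_cos, besselJ0]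
  field_simp

/-- The function `√x * J1 x`, which satisfies the ODE `D^2 w = -(1 - 3 / (4 * x ^ 2)) * w`. -/
noncomputable def sqrtJ1 (x : ℝ) : ℝ := √x * J1 x

/-- The derivative of `sqrtJ1` on the positive half-line. -/
noncomputable def sqrtJ1' (x : ℝ) : ℝ := √x * besselJ0 x - J1 x / (2 * √x)

lemma hasDerivAt_sqrtJ1 {x : ℝ} (hx : 0 < x) : HasDerivAt sqrtJ1 (sqrtJ1' x) x := by
  have h := (hasDerivAt_sqrt hx.ne').mul (hasDerivAt_J1 hx.ne')
  refine HasDerivAt.congr_deriv h ?_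
  have h2 := sq_sqrt hx.le
  have h3 := sqrt_pos.2 hx
  rw [sqrtJ1']
  set s := √x
  rw [← h2]
  field_simp
  ring

lemma hasDerivAt_sqrtJ1' {x : ℝ} (hx : 0 < x) :
    HasDerivAt sqrtJ1' (-(1 - 3 / (4 * x ^ 2)) * sqrtJ1 x) x := by
  have h3 := sqrt_pos.2 hx
  have h := ((hasDerivAt_sqrt hx.ne').mul (hasDerivAt_besselJ0 x)).sub
    ((hasDerivAt_J1 hx.ne').div ((hasDerivAt_sqrt hx.ne').const_mul 2) (by positivity))
  refine HasDerivAt.congr_deriv h ?_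
  have h2 := sq_sqrt hx.le
  rw [sqrtJ1]
  set s := √x
  rw [← h2]
  field_simp
  ring

lemma continuous_sqrtJ1 : Continuous sqrtJ1 := continuous_sqrt.mul continuous_J1

lemma abs_sqrtJ1'_le (x : ℝ) : |sqrtJ1' x| ≤ 3 / 2 * √x := by
  rcases le_or_gt x 0 with hx | hx
  · simp [sqrtJ1', sqrt_eq_zero_of_nonpos hx]
  have h3 := sqrt_pos.2 hx
  have h4 : |J1 x / (2 * √x)| ≤ 1 / 2 * √x := by
    rw [abs_div, abs_of_pos (by positivity : 0 < 2 * √x), div_le_iff₀ (by positivity)]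
    have := abs_J1_le_abs x
    rw [abs_of_pos hx] at this
    nlinarith [sq_sqrt hx.le]
  have h5 : |√x * besselJ0 x| ≤ √x := by
    rw [abs_mul, abs_of_pos h3]
    exact mul_le_of_le_one_right h3.le (abs_besselJ0_le_one x)
  rw [sqrtJ1']
  exact (abs_sub _ _).trans (by linarith)

lemma continuous_sqrtJ1' : Continuous sqrtJ1' := by
  refine continuous_iff_continuousAt.2 fun x => ?_
  rcases lt_trichotomy x 0 with hx | hx | hx
  · have : sqrtJ1' =ᶠ[𝓝 x] fun _ => 0 := by
      filter_upwards [Iio_mem_nhds hx] with y hy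
      simp [sqrtJ1', sqrt_eq_zero_of_nonpos (le_of_lt hy)]
    exact this.continuousAt
  · subst hx
    have h0 : sqrtJ1' 0 = 0 := by simp [sqrtJ1']
    rw [ContinuousAt, h0]
    refine squeeze_zero_norm abs_sqrtJ1'_le ?_
    have : Continuous fun x => 3 / 2 * √x := by fun_prop
    simpa using this.tendsto 0
  · exact (hasDerivAt_sqrtJ1' hx).continuousAt

/-- The energy of a solution of `D^2 w = -(1 - 3 / (4 * x ^ 2)) * w` is bounded at infinity. -/
lemma exists_abs_sqrtJ1_le : ∃ M > 0, ∀ x, |sqrtJ1 x| ≤ M ∧ |sqrtJ1' x| ≤ M := by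
  set E : ℝ → ℝ := fun x => exp (-(3 / 4) * (1 - x⁻¹)) * (sqrtJ1 x ^ 2 + sqrtJ1' x ^ 2) with hE
  have hd : ∀ x ∈ Set.Ici (1:ℝ), HasDerivAt E
      (exp (-(3 / 4) * (1 - x⁻¹)) * (-(3 / (4 * x ^ 2)) * (sqrtJ1 x - sqrtJ1' x) ^ 2)) x := by
    intro x hx
    have hx0 : 0 < x := lt_of_lt_of_le one_pos hx
    have h1 := ((((hasDerivAt_inv hx0.ne').const_sub 1).const_mul (-(3 / 4))).exp).mul
      (((hasDerivAt_sqrtJ1 hx0).pow 2).add ((hasDerivAt_sqrtJ1' hx0).pow 2))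
    refine HasDerivAt.congr_deriv h1 ?_
    simp only [Pi.add_apply, Pi.pow_apply]
    field_simp
    ring
  have hanti : AntitoneOn E (Set.Ici 1) := by
    refine antitoneOn_of_deriv_nonpos (convex_Ici 1)
      (fun x hx => (hd x hx).continuousAt.continuousWithinAt)
      (fun x hx => (hd x (interior_subset hx)).differentiableAt.differentiableWithinAt)
      fun x hx => ?_
    rw [(hd x (interior_subset hx)).deriv]
    have : 0 ≤ 3 / (4 * x ^ 2) * (sqrtJ1 x - sqrtJ1' x) ^ 2 := by positivity
    nlinarith [exp_pos (-(3 / 4) * (1 - x⁻¹))]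
  set B := exp (3 / 4) * E 1 with hB
  have hB0 : 0 ≤ B := by positivity
  have hbd : ∀ x, 1 ≤ x → sqrtJ1 x ^ 2 + sqrtJ1' x ^ 2 ≤ B := fun x hx => by
    have h1 := hanti (Set.mem_Ici.2 le_rfl) (Set.mem_Ici.2 hx) hx
    have h2 : exp (-(3 / 4)) ≤ exp (-(3 / 4) * (1 - x⁻¹)) := by
      refine exp_le_exp.2 ?_
      have : 0 ≤ x⁻¹ := by positivity
      linarith
    have h3 : exp (-(3 / 4)) * (sqrtJ1 x ^ 2 + sqrtJ1' x ^ 2) ≤ E 1 :=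
      (mul_le_mul_of_nonneg_right h2 (by positivity)).trans h1
    rw [hB]
    calc _ = exp (3 / 4) * (exp (-(3 / 4)) * (sqrtJ1 x ^ 2 + sqrtJ1' x ^ 2)) := by
          rw [← mul_assoc, ← exp_add]; simp
      _ ≤ _ := by gcongr
  refine ⟨2 + B, by positivity, fun x => ?_⟩
  rcases le_total x 1 with hx | hx
  · have h1 : √x ≤ 1 := sqrt_le_one.2 hx
    have h2 : |sqrtJ1 x| ≤ 1 := by
      rw [sqrtJ1, abs_mul, abs_of_nonneg (sqrt_nonneg x)]
      exact mul_le_one₀ h1 (abs_nonneg _) (abs_J1_le_one x)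
    constructor <;> linarith [abs_sqrtJ1'_le x]
  · have := hbd x hx
    constructor <;> refine abs_le_of_sq_le_sq ?_ (by positivity) <;> nlinarith

lemma exists_abs_sub_le_div {h h' : ℝ → ℝ} {c : ℝ} (hc : 0 ≤ c)
    (hd : ∀ x > 0, HasDerivAt h (h' x) x) (hb : ∀ x > 0, |h' x| ≤ c / x ^ 2) :
    ∃ A, ∀ x > 0, |h x - A| ≤ c / x := by
  have hinv : ∀ x > 0, HasDerivAt (fun x : ℝ => c / x) (-(c / x ^ 2)) x := fun x hx => by
    simpa [div_eq_mul_inv] using (hasDerivAt_inv (ne_of_gt hx)).const_mul c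
  have hmono : MonotoneOn (fun x => h x - c / x) (Set.Ioi 0) := by
    have hd' : ∀ x ∈ Set.Ioi (0:ℝ), HasDerivAt (fun x => h x - c / x) (h' x - -(c / x ^ 2)) x :=
      fun x hx => (hd x hx).sub (hinv x hx)
    refine monotoneOn_of_deriv_nonneg (convex_Ioi 0)
      (fun x hx => (hd' x hx).continuousAt.continuousWithinAt)
      (fun x hx => (hd' x (interior_subset hx)).differentiableAt.differentiableWithinAt)
      fun x hx => ?_
    rw [(hd' x (interior_subset hx)).deriv]
    linarith [(abs_le.1 (hb x (interior_subset hx))).1]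
  have hanti : AntitoneOn (fun x => h x + c / x) (Set.Ioi 0) := by
    have hd' : ∀ x ∈ Set.Ioi (0:ℝ), HasDerivAt (fun x => h x + c / x) (h' x + -(c / x ^ 2)) x :=
      fun x hx => (hd x hx).add (hinv x hx)
    refine antitoneOn_of_deriv_nonpos (convex_Ioi 0)
      (fun x hx => (hd' x hx).continuousAt.continuousWithinAt)
      (fun x hx => (hd' x (interior_subset hx)).differentiableAt.differentiableWithinAt)
      fun x hx => ?_
    rw [(hd' x (interior_subset hx)).deriv]
    linarith [(abs_le.1 (hb x (interior_subset hx))).2]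
  have hle : ∀ x > 0, ∀ y > 0, h x - c / x ≤ h y + c / y := fun x hx y hy => by
    have hz : 0 < max x y := lt_max_of_lt_left hx
    have h1 := hmono (Set.mem_Ioi.2 hx) (Set.mem_Ioi.2 hz) (le_max_left x y)
    have h2 := hanti (Set.mem_Ioi.2 hy) (Set.mem_Ioi.2 hz) (le_max_right x y)
    have h3 : 0 ≤ c / max x y := by positivity
    simp only at h1 h2
    linarith
  refine ⟨sSup ((fun x => h x - c / x) '' Set.Ioi 0), fun x hx => ?_⟩
  have h1 : h x - c / x ≤ sSup ((fun x => h x - c / x) '' Set.Ioi 0) :=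
    le_csSup ⟨h x + c / x, by rintro _ ⟨y, hy, rfl⟩; exact hle y hy x hx⟩ ⟨x, hx, rfl⟩
  have h2 : sSup ((fun x => h x - c / x) '' Set.Ioi 0) ≤ h x + c / x :=
    csSup_le ⟨_, x, hx, rfl⟩ (by rintro _ ⟨y, hy, rfl⟩; exact hle y hy x hx)
  rw [abs_le]
  constructor <;> linarith

lemma abs_mul_sin_le {a M : ℝ} (x : ℝ) (h : |a| ≤ M) : |a * sin x| ≤ M := by
  rw [abs_mul]
  exact (mul_le_of_le_one_right (abs_nonneg _) (abs_sin_le_one x)).trans h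

lemma abs_mul_cos_le {a M : ℝ} (x : ℝ) (h : |a| ≤ M) : |a * cos x| ≤ M := by
  rw [abs_mul]
  exact (mul_le_of_le_one_right (abs_nonneg _) (abs_cos_le_one x)).trans h

/-- First-order asymptotics of `√x * J1 x` and its derivative. -/
lemma exists_asymptotics_sqrtJ1 : ∃ A B M : ℝ, 0 < M ∧
    (∀ x, |sqrtJ1 x| ≤ M ∧ |sqrtJ1' x| ≤ M) ∧
    ∀ x > 0, |sqrtJ1 x - (A * cos x + B * sin x)| ≤ M / x ∧
      |sqrtJ1' x - (B * cos x - A * sin x)| ≤ M / x := by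
  obtain ⟨M, hM, hb⟩ := exists_abs_sqrtJ1_le
  have hbd : ∀ x : ℝ, |3 / (4 * x ^ 2) * sqrtJ1 x| ≤ M / x ^ 2 := fun x => by
    rw [abs_mul, abs_of_nonneg (by positivity : 0 ≤ 3 / (4 * x ^ 2))]
    calc _ ≤ 3 / (4 * x ^ 2) * M := by gcongr; exact (hb x).1
      _ = 3 / 4 * (M / x ^ 2) := by ring
      _ ≤ M / x ^ 2 := by
        have : 0 ≤ M / x ^ 2 := by positivity
        linarith
  have hα : ∀ x > 0, HasDerivAt (fun x => sqrtJ1 x * cos x - sqrtJ1' x * sin x)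
      (-(3 / (4 * x ^ 2) * sqrtJ1 x) * sin x) x := fun x hx => by
    refine HasDerivAt.congr_deriv (((hasDerivAt_sqrtJ1 hx).mul (hasDerivAt_cos x)).sub
      ((hasDerivAt_sqrtJ1' hx).mul (hasDerivAt_sin x))) ?_
    ring
  have hβ : ∀ x > 0, HasDerivAt (fun x => sqrtJ1 x * sin x + sqrtJ1' x * cos x)
      (3 / (4 * x ^ 2) * sqrtJ1 x * cos x) x := fun x hx => by
    refine HasDerivAt.congr_deriv (((hasDerivAt_sqrtJ1 hx).mul (hasDerivAt_sin x)).add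
      ((hasDerivAt_sqrtJ1' hx).mul (hasDerivAt_cos x))) ?_
    ring
  obtain ⟨A, hA⟩ := exists_abs_sub_le_div hM.le hα
    fun x _ => abs_mul_sin_le x (by rw [abs_neg]; exact hbd x)
  obtain ⟨B, hB⟩ := exists_abs_sub_le_div hM.le hβ fun x _ => abs_mul_cos_le x (hbd x)
  refine ⟨A, B, 2 * M, by positivity, fun x => ⟨?_, ?_⟩, fun x hx => ⟨?_, ?_⟩⟩
  · linarith [(hb x).1]
  · linarith [(hb x).2]
  · have h1 := abs_mul_cos_le x (hA x hx)
    have h2 := abs_mul_sin_le x (hB x hx)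
    have h3 : sqrtJ1 x - (A * cos x + B * sin x) =
        (sqrtJ1 x * cos x - sqrtJ1' x * sin x - A) * cos x +
          (sqrtJ1 x * sin x + sqrtJ1' x * cos x - B) * sin x := by
      linear_combination -(sqrtJ1 x) * sin_sq_add_cos_sq x
    rw [h3]
    refine (abs_add_le _ _).trans ?_
    rw [mul_div_assoc]
    linarith
  · have h1 := abs_mul_sin_le x (hA x hx)
    have h2 := abs_mul_cos_le x (hB x hx)
    have h3 : sqrtJ1' x - (B * cos x - A * sin x) =
        (sqrtJ1 x * sin x + sqrtJ1' x * cos x - B) * cos x -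
          (sqrtJ1 x * cos x - sqrtJ1' x * sin x - A) * sin x := by
      linear_combination -(sqrtJ1' x) * sin_sq_add_cos_sq x
    rw [h3]
    refine (abs_sub _ _).trans ?_
    rw [mul_div_assoc]
    linarith

/-- The kernel of the truncated inverse Hankel transform, in the normalisation of `sqrtJ1`. -/
noncomputable def hankelKernel (R r s : ℝ) : ℝ := ∫ p in (0:ℝ)..R, sqrtJ1 (p * r) * sqrtJ1 (p * s)

lemma continuous_hankelKernel (R r : ℝ) : Continuous (hankelKernel R r) := by
  have := continuous_sqrtJ1
  unfold hankelKernel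
  exact intervalIntegral.continuous_parametric_intervalIntegral_of_continuous'
    (by fun_prop) _ _

/-- The Lommel integral formula. -/
lemma mul_hankelKernel {R r s : ℝ} (hR : 0 ≤ R) (hr : 0 < r) (hs : 0 < s) :
    (s ^ 2 - r ^ 2) * hankelKernel R r s =
      r * sqrtJ1' (R * r) * sqrtJ1 (R * s) - s * sqrtJ1 (R * r) * sqrtJ1' (R * s) := by
  have hw := continuous_sqrtJ1
  have hv := continuous_sqrtJ1'
  have h := intervalIntegral.integral_eq_sub_of_hasDerivAt_of_le (a := 0) (b := R)
    (f := fun p => r * sqrtJ1' (p * r) * sqrtJ1 (p * s) - s * sqrtJ1 (p * r) * sqrtJ1' (p * s))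
    (f' := fun p => (s ^ 2 - r ^ 2) * (sqrtJ1 (p * r) * sqrtJ1 (p * s))) hR
    (by fun_prop) (fun p hp => ?_) (Continuous.intervalIntegrable (by fun_prop) _ _)
  · rw [hankelKernel, ← intervalIntegral.integral_const_mul, h]
    simp [sqrtJ1, J1_zero]
  · have hp : 0 < p := hp.1
    have hl : ∀ c : ℝ, HasDerivAt (fun p => p * c) c p := fun c => by
      simpa using (hasDerivAt_id p).mul_const c
    have hwc : ∀ c > 0, HasDerivAt (fun p => sqrtJ1 (p * c)) (sqrtJ1' (p * c) * c) p :=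
      fun c hc => HasDerivAt.comp (h₂ := sqrtJ1) p (hasDerivAt_sqrtJ1 (mul_pos hp hc)) (hl c)
    have hvc : ∀ c > 0, HasDerivAt (fun p => sqrtJ1' (p * c))
        (-(1 - 3 / (4 * (p * c) ^ 2)) * sqrtJ1 (p * c) * c) p :=
      fun c hc => HasDerivAt.comp (h₂ := sqrtJ1') p (hasDerivAt_sqrtJ1' (mul_pos hp hc)) (hl c)
    refine HasDerivAt.congr_deriv ((((hvc r hr).const_mul r).mul (hwc s hs)).sub
      (((hwc r hr).const_mul s).mul (hvc s hs))) ?_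
    field_simp
    ring

/-- The Wronskian-type expression in `mul_hankelKernel` is close to a sine. -/
lemma exists_abs_wronskian_sub_sin_le : ∃ c M : ℝ, 0 ≤ c ∧ 0 ≤ M ∧ ∀ x y, 1 ≤ x → x / 2 ≤ y →
    |sqrtJ1' x * sqrtJ1 y - sqrtJ1 x * sqrtJ1' y - c * sin (y - x)| ≤ M / x * |y - x| := by
  obtain ⟨A, B, M, hM, hb, has⟩ := exists_asymptotics_sqrtJ1
  set N := |A| + |B| with hN
  have hN0 : 0 ≤ N := by positivity
  refine ⟨A ^ 2 + B ^ 2, 2 * (M * M + N * (2 * M)) + 3 * (M * M), by positivity, by positivity,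
    fun x y hx hxy => ?_⟩
  have hx0 : 0 < x := by linarith
  set w₀ : ℝ → ℝ := fun x => A * cos x + B * sin x with hw₀
  set v₀ : ℝ → ℝ := fun x => B * cos x - A * sin x with hv₀
  have hw₀b : ∀ x, |w₀ x| ≤ N := fun x => (abs_add_le _ _).trans
    (add_le_add (abs_mul_cos_le x le_rfl) (abs_mul_sin_le x le_rfl))
  have hv₀b : ∀ x, |v₀ x| ≤ N := fun x => (abs_sub _ _).trans (by
    linarith [abs_mul_cos_le x (le_refl |B|), abs_mul_sin_le x (le_refl |A|)])
  have hprod : ∀ {a b a₀ b₀ y : ℝ}, x / 2 ≤ y → |b| ≤ M → |a₀| ≤ N → |a - a₀| ≤ M / x →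
      |b - b₀| ≤ M / y → |a * b - a₀ * b₀| ≤ (M * M + N * (2 * M)) / x := by
    intro a b a₀ b₀ y hy h1 h2 h3 h4
    have hMy : M / y ≤ 2 * M / x := by
      rw [div_le_div_iff₀ (by linarith) hx0]
      nlinarith
    have h5 : a * b - a₀ * b₀ = (a - a₀) * b + a₀ * (b - b₀) := by ring
    rw [h5]
    calc _ ≤ |a - a₀| * |b| + |a₀| * |b - b₀| := by
          simpa only [abs_mul] using abs_add_le ((a - a₀) * b) (a₀ * (b - b₀))
      _ ≤ M / x * M + N * (2 * M / x) := by gcongr; exact h4.trans hMy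
      _ = _ := by ring
  set e : ℝ → ℝ := fun y => sqrtJ1' x * sqrtJ1 y - sqrtJ1 x * sqrtJ1' y -
    (A ^ 2 + B ^ 2) * sin (y - x) with he
  have hd : ∀ y ∈ Set.Ici (x / 2), HasDerivWithinAt e (sqrtJ1' x * sqrtJ1' y -
      sqrtJ1 x * (-(1 - 3 / (4 * y ^ 2)) * sqrtJ1 y) - (A ^ 2 + B ^ 2) * (cos (y - x) * 1))
      (Set.Ici (x / 2)) y := fun y hy => by
    have hy0 : 0 < y := lt_of_lt_of_le (by linarith) (Set.mem_Ici.1 hy)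
    exact ((((hasDerivAt_sqrtJ1 hy0).const_mul _).sub ((hasDerivAt_sqrtJ1' hy0).const_mul _)).sub
      ((((hasDerivAt_id y).sub_const x).sin).const_mul _)).hasDerivWithinAt
  have hbd : ∀ y ∈ Set.Ici (x / 2), ‖sqrtJ1' x * sqrtJ1' y -
      sqrtJ1 x * (-(1 - 3 / (4 * y ^ 2)) * sqrtJ1 y) - (A ^ 2 + B ^ 2) * (cos (y - x) * 1)‖ ≤
      (2 * (M * M + N * (2 * M)) + 3 * (M * M)) / x := fun y hy => by
    have hy' : x / 2 ≤ y := hy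
    have hy0 : 0 < y := by linarith
    have h1 := hprod hy' (hb y).2 (hv₀b x) (has x hx0).2 (has y hy0).2
    have h2 := hprod hy' (hb y).1 (hw₀b x) (has x hx0).1 (has y hy0).1
    have h3 : |sqrtJ1 x * (3 / (4 * y ^ 2) * sqrtJ1 y)| ≤ 3 * (M * M) / x := by
      rw [abs_mul, abs_mul, abs_of_nonneg (by positivity : 0 ≤ 3 / (4 * y ^ 2))]
      have h4 : 3 / (4 * y ^ 2) ≤ 3 / x := by
        gcongr
        nlinarith
      calc _ ≤ M * (3 / x * M) := by
            gcongr
            · exact (hb x).1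
            · exact (hb y).1
        _ = _ := by ring
    have h5 : sqrtJ1' x * sqrtJ1' y - sqrtJ1 x * (-(1 - 3 / (4 * y ^ 2)) * sqrtJ1 y) -
        (A ^ 2 + B ^ 2) * (cos (y - x) * 1) =
        (sqrtJ1' x * sqrtJ1' y - v₀ x * v₀ y) + (sqrtJ1 x * sqrtJ1 y - w₀ x * w₀ y) -
          sqrtJ1 x * (3 / (4 * y ^ 2) * sqrtJ1 y) := by
      simp only [hw₀, hv₀, cos_sub]
      ring
    rw [h5, Real.norm_eq_abs, add_div, two_mul, add_div]
    refine (abs_sub _ _).trans (add_le_add ((abs_add_le _ _).trans (add_le_add h1 h2)) h3)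
  have := (convex_Ici (x / 2)).norm_image_sub_le_of_norm_hasDerivWithin_le hd hbd
    (x := x) (y := y) (Set.mem_Ici.2 (by linarith)) (Set.mem_Ici.2 hxy)
  simpa [he, mul_comm] using this

/-- Near the diagonal, the Hankel kernel is the Dirichlet kernel up to a bounded error. -/
lemma exists_abs_hankelKernel_sub_sinc_le {r : ℝ} (hr : 0 < r) : ∃ c M : ℝ, 0 ≤ c ∧ 0 ≤ M ∧
    ∀ R s, 1 ≤ R * r → r / 2 ≤ s → s ≠ r →
      |√s * hankelKernel R r s - c * (R * sinc (R * (s - r)))| ≤ M := by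
  obtain ⟨c, M₁, hc, hM₁, hW⟩ := exists_abs_wronskian_sub_sin_le
  obtain ⟨M₂, hM₂, hb⟩ := exists_abs_sqrtJ1_le
  have hr' := sqrt_pos.2 hr
  refine ⟨c * √r / 2, (M₁ + M₂ * M₂ + c) / (2 * √r), by positivity, by positivity,
    fun R s hR hs hsr => ?_⟩
  have hR0 : 0 < R := by
    by_contra! h
    nlinarith
  have hs0 : 0 < s := by linarith
  have hs' := sqrt_pos.2 hs0
  have hsr0 : s - r ≠ 0 := sub_ne_zero.2 hsr
  have habs : 0 < |s - r| := abs_pos.2 hsr0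
  set S := sin (R * s - R * r) with hS
  set e := sqrtJ1' (R * r) * sqrtJ1 (R * s) - sqrtJ1 (R * r) * sqrtJ1' (R * s) - c * S with he
  have heb : |r * e / (s - r)| ≤ M₁ := by
    have h1 := hW (R * r) (R * s) hR (by nlinarith)
    rw [← mul_sub, abs_mul, abs_of_pos hR0] at h1
    rw [abs_div, abs_mul, abs_of_pos hr, div_le_iff₀ habs]
    calc r * |e| ≤ r * (M₁ / (R * r) * (R * |s - r|)) := by gcongr; simpa [he, hS, mul_sub] using h1
      _ = M₁ * |s - r| := by field_simp
  have hwv : |sqrtJ1 (R * r) * sqrtJ1' (R * s)| ≤ M₂ * M₂ := by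
    rw [abs_mul]
    gcongr
    · exact (hb _).1
    · exact (hb _).2
  have hsinc : R * sinc (R * (s - r)) = S / (s - r) := by
    rw [sinc_of_ne_zero (mul_ne_zero hR0.ne' hsr0), hS, mul_sub]
    field_simp
  have hSb : |S / (s - r) * (√s - √r) ^ 2| ≤ 1 := by
    rw [abs_mul, abs_div, abs_of_nonneg (sq_nonneg (√s - √r)), div_mul_eq_mul_div,
      div_le_iff₀ habs]
    have h1 : s - r = (√s - √r) * (√s + √r) := by
      linear_combination -(sq_sqrt hs0.le) + sq_sqrt hr.le
    have h2 : (√s - √r) ^ 2 ≤ |s - r| := by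
      rw [h1, abs_mul, ← sq_abs, sq, abs_of_pos (by positivity : 0 < √s + √r)]
      gcongr
      rw [abs_le]
      constructor <;> linarith
    exact mul_le_mul (abs_sin_le_one _) h2 (sq_nonneg _) zero_le_one
  have hk := mul_hankelKernel hR0.le hr hs0
  have hk' : hankelKernel R r s =
      (r * (e + c * S) / (s - r) - sqrtJ1 (R * r) * sqrtJ1' (R * s)) / (s + r) := by
    rw [eq_div_iff (by positivity), eq_sub_iff_add_eq, eq_div_iff hsr0]
    linear_combination hk
  have hsq : √s / (s + r) = 1 / (2 * √r) - (√s - √r) ^ 2 / (2 * √r * (s + r)) := by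
    field_simp
    linear_combination sq_sqrt hs0.le + sq_sqrt hr.le
  have hsplit : √s * hankelKernel R r s - c * √r / 2 * (R * sinc (R * (s - r))) =
      √s / (s + r) * (r * e / (s - r) - sqrtJ1 (R * r) * sqrtJ1' (R * s)) -
        c / (2 * √r) * (r / (s + r) * (S / (s - r) * (√s - √r) ^ 2)) := by
    have h1 : √s * hankelKernel R r s = √s / (s + r) *
        (r * e / (s - r) - sqrtJ1 (R * r) * sqrtJ1' (R * s)) +
          √s / (s + r) * (r * c * S / (s - r)) := by
      rw [hk']
      ring
    have h2 : c * √r / 2 * (S / (s - r)) = 1 / (2 * √r) * (r * c * S / (s - r)) := by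
      have := sq_sqrt hr.le
      field_simp
      rw [this]
      ring
    have h3 : √s / (s + r) * (r * c * S / (s - r)) = 1 / (2 * √r) * (r * c * S / (s - r)) -
        c / (2 * √r) * (r / (s + r) * (S / (s - r) * (√s - √r) ^ 2)) := by
      rw [hsq]
      field_simp
    rw [hsinc, h1, h2, h3]
    ring
  have hsle : √s / (s + r) ≤ 1 / (2 * √r) := by
    rw [hsq]
    have : 0 ≤ (√s - √r) ^ 2 / (2 * √r * (s + r)) := by positivity
    linarith
  have hrle : r / (s + r) ≤ 1 := by
    rw [div_le_one (by positivity)]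
    linarith
  rw [hsplit]
  calc _ ≤ √s / (s + r) * (|r * e / (s - r)| + |sqrtJ1 (R * r) * sqrtJ1' (R * s)|) +
        c / (2 * √r) * (r / (s + r) * |S / (s - r) * (√s - √r) ^ 2|) := by
        refine (abs_sub _ _).trans (add_le_add ?_ ?_)
        · rw [abs_mul, abs_of_nonneg (by positivity : 0 ≤ √s / (s + r))]
          gcongr
          exact abs_sub _ _
        · rw [abs_mul, abs_mul, abs_of_nonneg (by positivity : 0 ≤ c / (2 * √r)),
            abs_of_nonneg (by positivity : 0 ≤ r / (s + r))]
    _ ≤ 1 / (2 * √r) * (M₁ + M₂ * M₂) + c / (2 * √r) * (1 * 1) := by gcongr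
    _ = _ := by ring

lemma exists_abs_integral_sqrt_mul_hankelKernel_le {r : ℝ} (hr : 0 < r) : ∃ M : ℝ, 0 ≤ M ∧
    ∀ R, 1 ≤ R * r → ∀ a b, r / 2 ≤ a → a ≤ b → b ≤ 2 * r →
      |∫ s in a..b, √s * hankelKernel R r s| ≤ M := by
  obtain ⟨c, M, hc, hM, h⟩ := exists_abs_hankelKernel_sub_sinc_le hr
  refine ⟨M * (2 * r) + c * 14, by positivity, fun R hR a b ha hab hb => ?_⟩
  have hk := continuous_hankelKernel R r
  have hsinc : ∫ s in a..b, c * (R * sinc (R * (s - r))) =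
      c * ∫ y in (R * a - R * r)..(R * b - R * r), sinc y := by
    rw [intervalIntegral.integral_const_mul, intervalIntegral.integral_const_mul,
      ← intervalIntegral.mul_integral_comp_mul_sub]
    simp only [mul_sub]
  have hsplit : ∫ s in a..b, √s * hankelKernel R r s =
      (∫ s in a..b, (√s * hankelKernel R r s - c * (R * sinc (R * (s - r))))) +
        ∫ s in a..b, c * (R * sinc (R * (s - r))) := by
    have := continuous_sinc
    rw [← intervalIntegral.integral_add (Continuous.intervalIntegrable (by fun_prop) _ _)
      (Continuous.intervalIntegrable (by fun_prop) _ _)]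
    simp
  have hdiff : ‖∫ s in a..b, (√s * hankelKernel R r s - c * (R * sinc (R * (s - r))))‖ ≤
      M * |b - a| := by
    refine intervalIntegral.norm_integral_le_of_norm_le_const_ae ?_
    filter_upwards [Measure.ae_ne volume r] with s hs hsm
    rw [Set.uIoc_of_le hab] at hsm
    exact h R s hR (ha.trans hsm.1.le) hs
  rw [abs_of_nonneg (sub_nonneg.2 hab), Real.norm_eq_abs] at hdiff
  rw [hsplit, hsinc]
  refine (abs_add_le _ _).trans (add_le_add (hdiff.trans ?_) ?_)
  · gcongr
    linarith
  · rw [abs_mul, abs_of_nonneg hc]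
    gcongr
    exact abs_integral_sinc_le _ _

lemma exists_abs_hankelKernel_le : ∃ M : ℝ, 0 ≤ M ∧ ∀ R r s, |hankelKernel R r s| ≤ M * |R| := by
  obtain ⟨M, hM, hb⟩ := exists_abs_sqrtJ1_le
  refine ⟨M * M, by positivity, fun R r s => ?_⟩
  have := intervalIntegral.norm_integral_le_of_norm_le_const (a := 0) (b := R) (C := M * M)
    (f := fun p => sqrtJ1 (p * r) * sqrtJ1 (p * s)) fun p _ => by
      rw [norm_mul]
      exact mul_le_mul (hb _).1 (hb _).1 (abs_nonneg _) hM.le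
  simpa [hankelKernel] using this

lemma tendsto_integral_mul_cos_sin {φ : ℝ → ℝ} (hφ : Integrable φ) :
    Tendsto (fun R => ∫ x, φ x * cos (R * x)) atTop (𝓝 0) ∧
      Tendsto (fun R => ∫ x, φ x * sin (R * x)) atTop (𝓝 0) := by
  have h := (Real.tendsto_integral_exp_smul_cocompact fun x => (φ x : ℂ)).comp
    ((tendsto_id.atTop_mul_const (by positivity : 0 < (2 * π)⁻¹)).mono_right atTop_le_cocompact)
  have heq : ∀ R x : ℝ, fourierChar (-(x * (R * (2 * π)⁻¹))) • (φ x : ℂ) =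
      Complex.exp ((-(R * x) : ℝ) * Complex.I) * φ x := fun R x => by
    rw [Circle.smul_def, Real.fourierChar_apply, smul_eq_mul]
    congr 4
    field_simp
  have hi : ∀ R : ℝ, Integrable fun x => Complex.exp ((-(R * x) : ℝ) * Complex.I) * φ x :=
    fun R => (hφ.ofReal (𝕜 := ℂ)).bdd_mul (c := 1)
      (by fun_prop) (ae_of_all _ fun x => (Complex.norm_exp_ofReal_mul_I _).le)
  simp only [Function.comp_def, id, heq] at h
  constructor
  · have h1 := (Complex.continuous_re.tendsto 0).comp h
    refine (h1.congr fun R => ?_)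
    refine (integral_re (hi R)).symm.trans (integral_congr_ae (ae_of_all _ fun x => ?_))
    simp only [RCLike.re_to_complex, Complex.re_mul_ofReal, Complex.exp_ofReal_mul_I_re, cos_neg]
    ring
  · have h1 := ((Complex.continuous_im.tendsto 0).comp h).neg
    simp only [Complex.zero_im, neg_zero] at h1
    refine (h1.congr fun R => ?_)
    refine (congrArg Neg.neg (integral_im (hi R)).symm).trans ((integral_neg _).symm.trans <|
      integral_congr_ae (ae_of_all _ fun x => ?_))
    simp only [RCLike.im_to_complex, Complex.im_mul_ofReal, Complex.exp_ofReal_mul_I_im, sin_neg]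
    ring

/-- A Riemann-Lebesgue lemma for functions asymptotic to a sinusoid. -/
lemma tendsto_setIntegral_mul_of_asymptotics {g φ : ℝ → ℝ} {A B M : ℝ} {T : Set ℝ}
    (hT : MeasurableSet T) (hT0 : T ⊆ Set.Ioi 0) (hφ : IntegrableOn φ T) (hg : Continuous g)
    (hgM : ∀ x, |g x| ≤ M) (has : ∀ x > 0, |g x - (A * cos x + B * sin x)| ≤ M / x) :
    Tendsto (fun R => ∫ s in T, φ s * g (R * s)) atTop (𝓝 0) := by
  have htrig := tendsto_integral_mul_cos_sin (hφ.integrable_indicator hT)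
  have hind : ∀ k : ℝ → ℝ, ∫ x, T.indicator φ x * k x = ∫ x in T, φ x * k x := fun k => by
    rw [← integral_indicator hT]
    congr 1 with x
    exact (Set.indicator_mul_left T φ k).symm
  simp only [hind] at htrig
  have hrem : Tendsto (fun R => ∫ s in T, φ s * (g (R * s) - (A * cos (R * s) + B * sin (R * s))))
      atTop (𝓝 (∫ _ in T, 0)) := by
    refine tendsto_integral_filter_of_dominated_convergence
      (fun s => |φ s| * (M + (|A| + |B|))) ?_ ?_ ?_ ?_
    · exact Eventually.of_forall fun R =>
        hφ.aestronglyMeasurable.mul (Continuous.aestronglyMeasurable (by fun_prop))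
    · refine Eventually.of_forall fun R => ae_of_all _ fun s => ?_
      rw [norm_mul, Real.norm_eq_abs, Real.norm_eq_abs]
      gcongr
      refine (abs_sub _ _).trans (add_le_add (hgM _) ((abs_add_le _ _).trans (add_le_add
        (abs_mul_cos_le _ le_rfl) (abs_mul_sin_le _ le_rfl))))
    · exact hφ.abs.mul_const _
    · filter_upwards [ae_restrict_mem hT] with s hs
      have hs0 : 0 < s := hT0 hs
      have hlim : Tendsto (fun R => |φ s| * (M / (R * s))) atTop (𝓝 0) := by
        simpa using ((tendsto_id.atTop_mul_const hs0).const_div_atTop M).const_mul |φ s|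
      refine squeeze_zero_norm' ?_ hlim
      filter_upwards [eventually_gt_atTop 0] with R hR
      rw [norm_mul, Real.norm_eq_abs, Real.norm_eq_abs]
      gcongr
      exact has _ (mul_pos hR hs0)
  have hsum := hrem.add ((htrig.1.const_mul A).add (htrig.2.const_mul B))
  simp only [integral_zero, mul_zero, add_zero] at hsum
  refine hsum.congr fun R => ?_
  have hcos : IntegrableOn (fun s => φ s * cos (R * s)) T :=
    hφ.mul_bdd (c := 1) (Continuous.aestronglyMeasurable (by fun_prop))
      (ae_of_all _ fun x => abs_cos_le_one _)
  have hsin : IntegrableOn (fun s => φ s * sin (R * s)) T :=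
    hφ.mul_bdd (c := 1) (Continuous.aestronglyMeasurable (by fun_prop))
      (ae_of_all _ fun x => abs_sin_le_one _)
  have hgi : IntegrableOn (fun s => φ s * g (R * s)) T :=
    hφ.mul_bdd (c := M) (Continuous.aestronglyMeasurable (by fun_prop))
      (ae_of_all _ fun x => hgM _)
  have hexp : ∀ s, φ s * (g (R * s) - (A * cos (R * s) + B * sin (R * s))) =
      φ s * g (R * s) - (A * (φ s * cos (R * s)) + B * (φ s * sin (R * s))) := fun s => by ring
  have hci : IntegrableOn (fun s => A * (φ s * cos (R * s))) T := hcos.const_mul A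
  have hsi : IntegrableOn (fun s => B * (φ s * sin (R * s))) T := hsin.const_mul B
  have hcsi : IntegrableOn (fun s => A * (φ s * cos (R * s)) + B * (φ s * sin (R * s))) T :=
    hci.add hsi
  simp only [hexp]
  rw [integral_sub hgi hcsi, integral_add hci hsi, integral_const_mul,
    integral_const_mul]
  ring

lemma tendsto_setIntegral_mul_sqrtJ1 {φ : ℝ → ℝ} {T : Set ℝ}
    (hT : MeasurableSet T) (hT0 : T ⊆ Set.Ioi 0) (hφ : IntegrableOn φ T) :
    Tendsto (fun R => ∫ s in T, φ s * sqrtJ1 (R * s)) atTop (𝓝 0) ∧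
      Tendsto (fun R => ∫ s in T, φ s * sqrtJ1' (R * s)) atTop (𝓝 0) := by
  obtain ⟨A, B, M, -, hb, has⟩ := exists_asymptotics_sqrtJ1
  refine ⟨tendsto_setIntegral_mul_of_asymptotics hT hT0 hφ continuous_sqrtJ1 (fun x => (hb x).1)
    fun x hx => (has x hx).1, tendsto_setIntegral_mul_of_asymptotics (A := B) (B := -A) hT hT0 hφ
      continuous_sqrtJ1' (fun x => (hb x).2) fun x hx => ?_⟩
  have := (has x hx).2
  rwa [sub_eq_add_neg (B * cos x), ← neg_mul] at this

/-- Away from the diagonal, the Hankel kernel does not contribute to the inversion formula. -/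
lemma tendsto_setIntegral_mul_hankelKernel {φ : ℝ → ℝ} {r δ : ℝ} (hr : 0 < r) (hδ : 0 < δ)
    (hφ : IntegrableOn φ (Set.Ioi 0)) :
    Tendsto (fun R => ∫ s in Set.Ioi 0 \ Set.Ioc (r - δ) (r + δ), φ s * hankelKernel R r s)
      atTop (𝓝 0) := by
  set T := Set.Ioi 0 \ Set.Ioc (r - δ) (r + δ) with hTdef
  have hT : MeasurableSet T := measurableSet_Ioi.diff measurableSet_Ioc
  have hT0 : T ⊆ Set.Ioi 0 := Set.sdiff_subset
  have hφT : IntegrableOn φ T := hφ.mono_set hT0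
  have hfar : ∀ s ∈ T, 0 < s ∧ δ * (s + r) ≤ |s ^ 2 - r ^ 2| := fun s hs => by
    have hs0 : 0 < s := hs.1
    refine ⟨hs0, ?_⟩
    have h1 : s ^ 2 - r ^ 2 = (s - r) * (s + r) := by ring
    rw [h1, abs_mul, abs_of_pos (by positivity : 0 < s + r)]
    gcongr
    rcases le_or_gt s (r - δ) with h | h
    · rw [abs_of_neg] <;> linarith
    · have h2 : r + δ < s := by
        by_contra! h3
        exact hs.2 ⟨h, h3⟩
      rw [abs_of_pos] <;> linarith
  have hint : ∀ q : ℝ → ℝ, Measurable q → (∀ s > 0, |q s| ≤ s + r) →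
      IntegrableOn (fun s => φ s * (q s / (s ^ 2 - r ^ 2))) T := fun q hq hqb => by
    refine hφT.mul_bdd (c := 1 / δ) (Measurable.aestronglyMeasurable (by fun_prop)) ?_
    filter_upwards [ae_restrict_mem hT] with s hs
    obtain ⟨hs0, hs1⟩ := hfar s hs
    have hsr : 0 < s + r := by positivity
    rw [Real.norm_eq_abs, abs_div, div_le_div_iff₀ (lt_of_lt_of_le (by positivity) hs1) hδ]
    nlinarith [hqb s hs0]
  have hr1 := hint (fun _ => r) (by fun_prop) fun s hs => by rw [abs_of_pos hr]; linarith
  have hs1 := hint (fun s => s) (by fun_prop) fun s hs => by rw [abs_of_pos hs]; linarith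
  obtain ⟨M, hM, hb⟩ := exists_abs_sqrtJ1_le
  have hbd : ∀ {u v : ℝ → ℝ}, (∀ x, |u x| ≤ M) → Tendsto v atTop (𝓝 0) →
      Tendsto (fun R => u (R * r) * v R) atTop (𝓝 0) := fun hu hv => by
    refine squeeze_zero_norm (fun R => ?_) (by simpa using hv.abs.const_mul M)
    rw [norm_mul, Real.norm_eq_abs, Real.norm_eq_abs]
    gcongr
    exact hu _
  have hlim := (hbd (fun x => (hb x).2) (tendsto_setIntegral_mul_sqrtJ1 hT hT0 hr1).1).sub
    (hbd (fun x => (hb x).1) (tendsto_setIntegral_mul_sqrtJ1 hT hT0 hs1).2)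
  rw [sub_zero] at hlim
  refine hlim.congr' ?_
  filter_upwards [eventually_ge_atTop 0] with R hR
  have hw := continuous_sqrtJ1
  have hv := continuous_sqrtJ1'
  have i1 : IntegrableOn (fun s => sqrtJ1' (R * r) *
      (φ s * (r / (s ^ 2 - r ^ 2)) * sqrtJ1 (R * s))) T :=
    (hr1.mul_bdd (c := M) (Continuous.aestronglyMeasurable (by fun_prop))
      (ae_of_all _ fun x => (hb _).1)).const_mul _
  have i2 : IntegrableOn (fun s => sqrtJ1 (R * r) *
      (φ s * (s / (s ^ 2 - r ^ 2)) * sqrtJ1' (R * s))) T :=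
    (hs1.mul_bdd (c := M) (Continuous.aestronglyMeasurable (by fun_prop))
      (ae_of_all _ fun x => (hb _).2)).const_mul _
  rw [← integral_const_mul, ← integral_const_mul, ← integral_sub i1 i2]
  refine setIntegral_congr_fun hT fun s hs => ?_
  obtain ⟨hs0, hs2⟩ := hfar s hs
  have hne : s ^ 2 - r ^ 2 ≠ 0 := abs_pos.1 (lt_of_lt_of_le (by positivity) hs2)
  have hk : hankelKernel R r s = (r * sqrtJ1' (R * r) * sqrtJ1 (R * s) -
      s * sqrtJ1 (R * r) * sqrtJ1' (R * s)) / (s ^ 2 - r ^ 2) := by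
    rw [eq_div_iff hne, ← mul_hankelKernel hR hr hs0]
    ring
  simp only [hk]
  ring

lemma integrableOn_mul_hankelKernel {φ : ℝ → ℝ} {T : Set ℝ} (hφ : IntegrableOn φ T) (R r : ℝ) :
    IntegrableOn (fun s => φ s * hankelKernel R r s) T := by
  obtain ⟨M, -, hM⟩ := exists_abs_hankelKernel_le
  exact hφ.mul_bdd (continuous_hankelKernel R r).aestronglyMeasurable
    (ae_of_all _ fun s => hM R r s)

lemma tendsto_integral_mul_hankelKernel_of_eq_zero {f : ℝ → ℝ} {r : ℝ} (hr : 0 < r)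
    (hfc : ContinuousAt f r) (hf : BoundedVariationOn f (Set.Icc (r / 2) (2 * r)))
    (hint : IntegrableOn (fun s => f s * √s) (Set.Ioi 0)) (hfr : f r = 0) :
    Tendsto (fun R => ∫ s in Set.Ioi 0, f s * √s * hankelKernel R r s) atTop (𝓝 0) := by
  obtain ⟨M, hM, hk⟩ := exists_abs_integral_sqrt_mul_hankelKernel_le hr
  rw [Metric.tendsto_nhds]
  intro ε hε
  obtain ⟨δ, hδ, hδ1, hδ2, hdiag⟩ := exists_abs_integral_mul_le_of_boundedVariationOn
    (a := r / 2) (b := 2 * r) (by linarith) (by linarith) hf hfc hfr (half_pos hε) hM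
  have hoff := tendsto_setIntegral_mul_hankelKernel hr hδ hint
  rw [Metric.tendsto_nhds] at hoff
  filter_upwards [hoff _ (half_pos hε), eventually_ge_atTop (1 / r)] with R h1 h2
  have hR : 1 ≤ R * r := (div_le_iff₀ hr).1 h2
  have h3 := hdiag (fun s => √s * hankelKernel R r s)
    (by have := continuous_hankelKernel R r; fun_prop) (hk R hR)
  rw [Real.dist_eq, sub_zero] at h1 ⊢
  have hsub : Set.Ioc (r - δ) (r + δ) ⊆ Set.Ioi 0 :=
    fun x hx => Set.mem_Ioi.2 (lt_trans (by linarith) hx.1)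
  rw [← integral_inter_add_sdiff (measurableSet_Ioc (a := r - δ) (b := r + δ))
    (integrableOn_mul_hankelKernel hint R r), Set.inter_eq_right.2 hsub,
    ← intervalIntegral.integral_of_le (by linarith)]
  simp only [← mul_assoc] at h3
  refine (abs_add_le _ _).trans_lt ?_
  linarith

lemma sqrtJ1_mul_mul_sqrtJ1_mul {p r s : ℝ} (hp : 0 ≤ p) (hs : 0 ≤ s) :
    √s * (sqrtJ1 (p * r) * sqrtJ1 (p * s)) = √r * (J1 (p * s) * s * J1 (p * r) * p) := by
  simp only [sqrtJ1, sqrt_mul hp]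
  linear_combination (√r * J1 (p * r) * J1 (p * s)) * (√p ^ 2 * sq_sqrt hs + s * sq_sqrt hp)

/-- The truncated inverse Hankel transform as an integral operator. -/
lemma integral_hankel_eq {f : ℝ → ℝ} {R r : ℝ} (hR : 0 ≤ R) (hr : 0 < r)
    (hint : IntegrableOn (fun s => f s * √s) (Set.Ioi 0)) :
    ∫ p in (0:ℝ)..R, (∫ s in Set.Ioi (0:ℝ), f s * J1 (p * s) * s) * J1 (p * r) * p =
      (∫ s in Set.Ioi 0, f s * √s * hankelKernel R r s) / √r := by
  have hw := continuous_sqrtJ1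
  obtain ⟨M, hM, hb⟩ := exists_abs_sqrtJ1_le
  have : IsFiniteMeasure (volume.restrict (Set.uIoc 0 R)) := by
    rw [Set.uIoc_of_le hR]
    infer_instance
  have hF : Integrable (Function.uncurry fun p s => f s * √s * (sqrtJ1 (p * r) * sqrtJ1 (p * s)))
      ((volume.restrict (Set.uIoc 0 R)).prod (volume.restrict (Set.Ioi 0))) := by
    refine (hint.comp_snd _).mul_bdd (c := M * M)
      (g := fun z : ℝ × ℝ => sqrtJ1 (z.1 * r) * sqrtJ1 (z.1 * z.2))
      (Continuous.aestronglyMeasurable (by fun_prop)) (ae_of_all _ fun z => ?_)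
    rw [norm_mul]
    exact mul_le_mul (hb _).1 (hb _).1 (abs_nonneg _) hM.le
  have hswap := intervalIntegral_integral_swap hF
  simp only [intervalIntegral.integral_const_mul] at hswap
  rw [eq_div_iff (sqrt_pos.2 hr).ne', mul_comm, ← intervalIntegral.integral_const_mul]
  refine Eq.trans ?_ hswap
  refine intervalIntegral.integral_congr fun p hp => ?_
  rw [Set.uIcc_of_le hR] at hp
  rw [mul_assoc, ← integral_mul_const, ← integral_const_mul]
  refine setIntegral_congr_fun measurableSet_Ioi fun s hs => ?_
  have := sqrtJ1_mul_mul_sqrtJ1_mul (r := r) hp.1 (Set.mem_Ioi.1 hs).le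
  linear_combination -f s * this

/-- The function `s * exp (-s ^ 2 / 2)`, which is its own Hankel transform of order one. -/
noncomputable def selfHankel (s : ℝ) : ℝ := s * exp (-s ^ 2 / 2)

lemma continuous_selfHankel : Continuous selfHankel := by
  unfold selfHankel
  fun_prop

lemma hasDerivAt_exp_neg_sq_div_two (s : ℝ) :
    HasDerivAt (fun s : ℝ => exp (-s ^ 2 / 2)) (-selfHankel s) s := by
  refine HasDerivAt.congr_deriv ((((hasDerivAt_pow 2 s).neg).div_const 2).exp) ?_
  simp [selfHankel]
  ring

lemma integrableOn_rpow_mul_exp_neg_sq_div_two {a : ℝ} (ha : -1 < a) :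
    IntegrableOn (fun s : ℝ => s ^ a * exp (-s ^ 2 / 2)) (Set.Ioi 0) := by
  refine (integrable_rpow_mul_exp_neg_mul_sq (b := 1 / 2) (by norm_num) ha).integrableOn.congr_fun
    (fun s _ => ?_) measurableSet_Ioi
  simp only
  congr 2
  ring

lemma integrableOn_selfHankel : IntegrableOn selfHankel (Set.Ioi 0) := by
  simpa only [rpow_one] using! integrableOn_rpow_mul_exp_neg_sq_div_two (a := 1) (by norm_num)

lemma integrableOn_selfHankel_mul : IntegrableOn (fun s => selfHankel s * s) (Set.Ioi 0) := by
  refine (integrableOn_rpow_mul_exp_neg_sq_div_two (a := 2) (by norm_num)).congr_fun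
    (fun s _ => ?_) measurableSet_Ioi
  simp only [selfHankel, rpow_ofNat]
  ring

lemma integrableOn_selfHankel_mul_sqrt :
    IntegrableOn (fun s => selfHankel s * √s) (Set.Ioi 0) := by
  refine (integrableOn_rpow_mul_exp_neg_sq_div_two (a := 1 + 1 / 2) (by norm_num)).congr_fun
    (fun s hs => ?_) measurableSet_Ioi
  simp only [selfHankel, rpow_add (Set.mem_Ioi.1 hs), rpow_one, ← sqrt_eq_rpow]
  ring

lemma tendsto_selfHankel_atTop : Tendsto selfHankel atTop (𝓝 0) := by
  have h := rpow_mul_exp_neg_mul_sq_isLittleO_exp_neg (b := 1 / 2) (by norm_num) 1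
  refine (h.trans_tendsto (tendsto_exp_neg_atTop_nhds_zero.comp
    (tendsto_id.const_mul_atTop (by norm_num : (0:ℝ) < 1 / 2)) |>.congr fun x => ?_)).congr
      fun x => ?_
  · simp
  · simp only [selfHankel, rpow_one]
    congr 2
    ring

lemma integral_selfHankel : ∫ s in Set.Ioi 0, selfHankel s = 1 := by
  have h := integral_Ioi_of_hasDerivAt_of_tendsto (a := 0) (f := fun s : ℝ => -exp (-s ^ 2 / 2))
    (f' := selfHankel) (m := 0) (by fun_prop)
    (fun s _ => (hasDerivAt_exp_neg_sq_div_two s).fun_neg.congr_deriv (neg_neg _))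
    integrableOn_selfHankel ?_
  · rw [h]
    simp
  · rw [← neg_zero]
    refine (tendsto_exp_atBot.comp ?_).neg
    have : Tendsto (fun s : ℝ => s ^ 2 / 2) atTop atTop :=
      (tendsto_pow_atTop two_ne_zero).atTop_div_const two_pos
    refine (tendsto_neg_atTop_atBot.comp this).congr fun s => ?_
    simp [neg_div]

lemma integrableOn_selfHankel_mul_J1_mul (p : ℝ) :
    IntegrableOn (fun s => selfHankel s * J1 (p * s) * s) (Set.Ioi 0) := by
  have hJ1 := continuous_J1
  refine (integrableOn_selfHankel_mul.mul_bdd (c := 1) (g := fun s => J1 (p * s))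
    (Continuous.aestronglyMeasurable (by fun_prop))
    (ae_of_all _ fun s => abs_J1_le_one _)).congr (ae_of_all _ fun s => ?_)
  ring

lemma integral_selfHankel_mul_J1_eq (p : ℝ) :
    ∫ s in Set.Ioi 0, selfHankel s * J1 (p * s) * s =
      p * ∫ s in Set.Ioi 0, selfHankel s * besselJ0 (p * s) := by
  rcases eq_or_ne p 0 with rfl | hp
  · simp [J1_zero]
  have hJ0 := continuous_besselJ0
  have hJ1 := continuous_J1
  have i1 := integrableOn_selfHankel_mul_J1_mul p
  have i2 : IntegrableOn (fun s => p * (selfHankel s * besselJ0 (p * s))) (Set.Ioi 0) :=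
    (integrableOn_selfHankel.mul_bdd (c := 1) (g := fun s => besselJ0 (p * s))
      (Continuous.aestronglyMeasurable (by fun_prop))
      (ae_of_all _ fun s => abs_besselJ0_le_one _)).const_mul p
  have h := integral_Ioi_of_hasDerivAt_of_tendsto (a := 0)
    (f := fun s : ℝ => -exp (-s ^ 2 / 2) * (s * J1 (p * s)))
    (f' := fun s => selfHankel s * J1 (p * s) * s - p * (selfHankel s * besselJ0 (p * s)))
    (m := 0) (by fun_prop) (fun s hs => ?_) (i1.sub i2) ?_
  · rw [integral_sub i1 i2, integral_const_mul] at h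
    simp only [zero_mul, mul_zero, sub_zero] at h
    linarith
  · have hs0 : s ≠ 0 := (Set.mem_Ioi.1 hs).ne'
    have hl : HasDerivAt (fun s => p * s) p s := by
      simpa using (hasDerivAt_id s).const_mul p
    have hJ : HasDerivAt (fun s => J1 (p * s)) ((besselJ0 (p * s) - J1 (p * s) / (p * s)) * p) s :=
      HasDerivAt.comp (h₂ := J1) s (hasDerivAt_J1 (mul_ne_zero hp hs0)) hl
    refine HasDerivAt.congr_deriv
      ((hasDerivAt_exp_neg_sq_div_two s).fun_neg.mul ((hasDerivAt_id s).mul hJ)) ?_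
    simp only [selfHankel, id]
    field_simp
    ring
  · refine squeeze_zero_norm' ?_ tendsto_selfHankel_atTop
    filter_upwards [eventually_ge_atTop 0] with s hs
    rw [norm_mul, norm_neg, norm_mul, Real.norm_of_nonneg (exp_pos _).le, Real.norm_of_nonneg hs,
      selfHankel, mul_comm s (exp _)]
    exact mul_le_mul_of_nonneg_left (mul_le_of_le_one_right hs (abs_J1_le_one _)) (exp_pos _).le

lemma hasDerivAt_integral_selfHankel_mul_besselJ0 (p : ℝ) :
    HasDerivAt (fun p => ∫ s in Set.Ioi 0, selfHankel s * besselJ0 (p * s))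
      (-∫ s in Set.Ioi 0, selfHankel s * J1 (p * s) * s) p := by
  have hJ0 := continuous_besselJ0
  have hJ1 := continuous_J1
  have hg := continuous_selfHankel
  rw [← integral_neg]
  refine (hasDerivAt_integral_of_dominated_loc_of_deriv_le (s := Set.univ)
    (bound := fun s => |selfHankel s * s|)
    (F := fun p s => selfHankel s * besselJ0 (p * s))
    (F' := fun p s => -(selfHankel s * J1 (p * s) * s)) univ_mem
    (Eventually.of_forall fun p => Continuous.aestronglyMeasurable (by fun_prop))
    (integrableOn_selfHankel.mul_bdd (c := 1) (g := fun s => besselJ0 (p * s))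
      (Continuous.aestronglyMeasurable (by fun_prop))
      (ae_of_all _ fun s => abs_besselJ0_le_one _))
    (Continuous.aestronglyMeasurable (by fun_prop))
    (ae_of_all _ fun s q _ => ?_) integrableOn_selfHankel_mul.abs
    (ae_of_all _ fun s q _ => ?_)).2
  · rw [norm_neg, mul_right_comm, norm_mul]
    exact mul_le_of_le_one_right (abs_nonneg _) (abs_J1_le_one _)
  · have hl : HasDerivAt (fun q => q * s) s q := by
      simpa using (hasDerivAt_id q).mul_const s
    have hJ : HasDerivAt (fun q => besselJ0 (q * s)) (-J1 (q * s) * s) q :=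
      HasDerivAt.comp (h₂ := besselJ0) q (hasDerivAt_besselJ0 _) hl
    exact (hJ.const_mul (selfHankel s)).congr_deriv (by ring)

lemma integral_selfHankel_mul_J1 (p : ℝ) :
    ∫ s in Set.Ioi 0, selfHankel s * J1 (p * s) * s = selfHankel p := by
  set H : ℝ → ℝ := fun p => ∫ s in Set.Ioi 0, selfHankel s * besselJ0 (p * s) with hH
  have hd : ∀ p, HasDerivAt (fun p => H p * exp (p ^ 2 / 2)) 0 p := fun p => by
    have h1 := hasDerivAt_integral_selfHankel_mul_besselJ0 p
    rw [integral_selfHankel_mul_J1_eq] at h1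
    refine HasDerivAt.congr_deriv (h1.mul (((hasDerivAt_pow 2 p).div_const 2).exp)) ?_
    simp
    ring
  have hc := is_const_of_deriv_eq_zero (fun p => (hd p).differentiableAt)
    (fun p => (hd p).deriv) p 0
  have hH0 : H 0 = 1 := by
    simp [hH, besselJ0_zero, integral_selfHankel]
  have hHp : H p = exp (-p ^ 2 / 2) := by
    simp only [hH0] at hc
    rw [neg_div, exp_neg, ← mul_eq_one_iff_eq_inv₀ (exp_ne_zero _), hc]
    simp
  rw [integral_selfHankel_mul_J1_eq, selfHankel, ← hHp]

lemma tendsto_integral_selfHankel (r : ℝ) :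
    Tendsto (fun R => ∫ p in (0:ℝ)..R,
      (∫ s in Set.Ioi (0:ℝ), selfHankel s * J1 (p * s) * s) * J1 (p * r) * p)
      atTop (𝓝 (selfHankel r)) := by
  simp only [integral_selfHankel_mul_J1]
  rw [← integral_selfHankel_mul_J1 r]
  simp only [mul_comm r]
  refine intervalIntegral_tendsto_integral_Ioi 0 ?_ tendsto_id
  simpa only [mul_comm r] using integrableOn_selfHankel_mul_J1_mul r

lemma boundedVariationOn_selfHankel {a b : ℝ} (hab : a ≤ b) :
    BoundedVariationOn selfHankel (Set.Icc a b) := by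
  have hC : ContDiff ℝ 1 selfHankel := by
    unfold selfHankel
    fun_prop
  obtain ⟨K, hK⟩ := hC.contDiffOn.exists_lipschitzOnWith (s := Set.Icc a b) one_ne_zero
    (convex_Icc a b) isCompact_Icc
  simpa using hK.locallyBoundedVariationOn a b (Set.left_mem_Icc.2 hab) (Set.right_mem_Icc.2 hab)

lemma BoundedVariationOn.add_const_mul {f g : ℝ → ℝ} {s : Set ℝ} (hf : BoundedVariationOn f s)
    (hg : BoundedVariationOn g s) (c : ℝ) : BoundedVariationOn (fun x => f x + c * g x) s := by
  refine ne_top_of_le_ne_top (ENNReal.add_ne_top.2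
    ⟨hf, ENNReal.mul_ne_top ENNReal.coe_ne_top hg⟩) (iSup_le fun p => ?_ :
      _ ≤ eVariationOn f s + ‖c‖₊ * eVariationOn g s)
  calc _ ≤ ∑ i ∈ Finset.range p.1, (edist (f (p.2.1 (i + 1))) (f (p.2.1 i)) +
        ‖c‖₊ * edist (g (p.2.1 (i + 1))) (g (p.2.1 i))) := by
        gcongr with i _
        refine (edist_add_add_le _ _ _ _).trans_eq ?_
        rw [← smul_eq_mul, ← smul_eq_mul, edist_smul₀, ENNReal.smul_def, smul_eq_mul]
    _ ≤ _ := by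
      rw [Finset.sum_add_distrib, ← Finset.mul_sum]
      gcongr
      · exact eVariationOn.sum_le p.2.2.1 p.2.2.2
      · exact eVariationOn.sum_le p.2.2.1 p.2.2.2

theorem hankel_inversion_J1 (f : ℝ → ℝ)
    (hcont : ContinuousOn f (Set.Ioi 0))
    (hbv : ∀ a b : ℝ, 0 < a → a ≤ b → BoundedVariationOn f (Set.Icc a b))
    (hint : IntegrableOn (fun r => |f r| * Real.sqrt r) (Set.Ioi 0)) :
    ∀ r > (0:ℝ),
      Tendsto
        (fun R => ∫ p in (0:ℝ)..R,
          (∫ s in Set.Ioi (0:ℝ), f s * J1 (p * s) * s) * J1 (p * r) * p)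
        atTop (𝓝 (f r)) := by
  intro r hr
  have hfint : IntegrableOn (fun s => f s * √s) (Set.Ioi 0) := by
    refine Integrable.mono hint ((hcont.mul continuous_sqrt.continuousOn).aestronglyMeasurable
      measurableSet_Ioi) (ae_of_all _ fun s => ?_)
    simp
  have hgr : selfHankel r ≠ 0 := mul_ne_zero hr.ne' (exp_ne_zero _)
  set c := -(f r / selfHankel r) with hc
  have hgint := integrableOn_selfHankel_mul_sqrt
  have hcgint : IntegrableOn (fun s => c * (selfHankel s * √s)) (Set.Ioi 0) := hgint.const_mul c
  have hzint : IntegrableOn (fun s => (f s + c * selfHankel s) * √s) (Set.Ioi 0) :=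
    (hfint.add hcgint).congr_fun (fun s _ => by simp only [Pi.add_apply]; ring) measurableSet_Ioi
  have hz := tendsto_integral_mul_hankelKernel_of_eq_zero
    (f := fun s => f s + c * selfHankel s) hr
    ((hcont.continuousAt (Ioi_mem_nhds hr)).add
      (continuous_selfHankel.continuousAt.const_smul c))
    ((hbv _ _ (by linarith) (by linarith)).add_const_mul
      (boundedVariationOn_selfHankel (by linarith)) c) hzint
    (by rw [hc]; field_simp; ring)
  have hlim := (hz.div_const √r).sub ((tendsto_integral_selfHankel r).const_mul c)
  have hval : 0 / √r - c * selfHankel r = f r := by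
    rw [hc]
    field_simp
    ring
  rw [hval] at hlim
  refine hlim.congr' ?_
  filter_upwards [eventually_ge_atTop 0] with R hR
  rw [integral_hankel_eq hR hr hgint, integral_hankel_eq hR hr hfint]
  have hsplit : ∫ s in Set.Ioi 0, (f s + c * selfHankel s) * √s * hankelKernel R r s =
      (∫ s in Set.Ioi 0, f s * √s * hankelKernel R r s) +
        c * ∫ s in Set.Ioi 0, selfHankel s * √s * hankelKernel R r s := by
    have h2 : IntegrableOn (fun s => c * (selfHankel s * √s * hankelKernel R r s)) (Set.Ioi 0) :=
      (integrableOn_mul_hankelKernel hgint R r).const_mul c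
    rw [← integral_const_mul, ← integral_add (integrableOn_mul_hankelKernel hfint R r) h2]
    congr 1 with s
    ring
  rw [hsplit]
  ring
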